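/- Let d ≥ 3 and let X = (Fin d → ℝ) and Y = (Fin d → ℝ) carry 1-unconditional, strictly monotone norms, both one-p-convex for some 2 < p < ∞, and let U : X → Y be a surjective linear isometry. For each index m let H_m = {x ∈ X : x m = 0} and let g_m be a nonzero linear functional on Y with U(H_m) = ker g_m (such g_m exists and its support supp g_m = {ν : g_m(f_ν) ≠ 0} does not depend on the choice). Then for every index k there is at most one index l ≠ k with supp g_l ∩ supp g_k ≠ ∅: if l and t are indices different from k with supp g_l ∩ supp g_k ≠ ∅ and supp g_t ∩ supp g_k ≠ ∅, then l = t. -/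

import Mathlib

open MeasureTheory in
lemma aux_change {d : ℕ} (f : (Fin d → ℝ) →ₗ[ℝ] (Fin d → ℝ)) (hf : LinearMap.det f ≠ 0)
    (φ : (Fin d → ℝ) → ℝ) : ∫ x, φ (f x) = |LinearMap.det f|⁻¹ * ∫ y, φ y := by
  have h1 := Real.map_linearMap_volume_pi_eq_smul_volume_pi hf
  let e : (Fin d → ℝ) ≃L[ℝ] (Fin d → ℝ) := (LinearEquiv.ofIsUnitDet (f := f) (v := Pi.basisFun ℝ (Fin d)) (v' := Pi.basisFun ℝ (Fin d)) (by
    rw [LinearMap.det_toMatrix]; exact isUnit_iff_ne_zero.2 hf)).toContinuousLinearEquiv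
  have he : ∀ x, e x = f x := fun x => rfl
  have h2 : ∫ y, φ y ∂(Measure.map f volume) = ∫ x, φ (f x) :=
    (e.toHomeomorph.measurableEmbedding.integral_map φ)
  rw [← h2, h1, integral_smul_measure, ENNReal.toReal_ofReal (abs_nonneg _), abs_inv]
  rfl

structure NormLike {d : ℕ} (N : (Fin d → ℝ) → ℝ) : Prop where
  add : ∀ x y, N (x + y) ≤ N x + N y
  smul : ∀ (c : ℝ) (x), N (c • x) = |c| * N x
  ne : ∀ x, N x = 0 → x = 0
  unc : ∀ x y : Fin d → ℝ, (∀ i, |x i| ≤ |y i|) → N x ≤ N y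

namespace NormLike
variable {d : ℕ} {N : (Fin d → ℝ) → ℝ}

lemma zero (h : NormLike N) : N 0 = 0 := by
  have := h.smul 0 0
  simpa using this

lemma nonneg (h : NormLike N) (x) : 0 ≤ N x := by
  rw [← h.zero]
  exact h.unc _ _ (by simp)

lemma pos (h : NormLike N) {x} (hx : x ≠ 0) : 0 < N x :=
  lt_of_le_of_ne (h.nonneg x) (fun e => hx (h.ne x e.symm))

lemma single_pos (h : NormLike N) (i : Fin d) : 0 < N (Pi.single i 1) :=
  h.pos (by simp)

lemma single_eq (h : NormLike N) (i : Fin d) (c : ℝ) :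
    N (Pi.single i c) = |c| * N (Pi.single i 1) := by
  rw [← h.smul, ← Pi.single_smul]; simp

lemma le_sum (h : NormLike N) (x) : N x ≤ ∑ i, |x i| * N (Pi.single i 1) := by
  have key : ∀ s : Finset (Fin d), N (∑ i ∈ s, Pi.single i (x i)) ≤ ∑ i ∈ s, |x i| * N (Pi.single i 1) := by
    intro s
    induction s using Finset.induction_on with
    | empty => simp [h.zero]
    | insert a s ha ih =>
      rw [Finset.sum_insert ha, Finset.sum_insert ha]
      refine (h.add _ _).trans ?_
      rw [h.single_eq]
      linarith
  have := key Finset.univ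
  rwa [Finset.univ_sum_single] at this

lemma coord_le (h : NormLike N) (x) (i : Fin d) : |x i| * N (Pi.single i 1) ≤ N x := by
  rw [← h.single_eq]
  apply h.unc
  intro j
  by_cases hj : j = i
  · subst hj; simp
  · simp [hj]

lemma cont (h : NormLike N) : Continuous N := by
  rw [continuous_iff_continuousAt]
  intro x
  have hb : ∀ y, ‖N y - N x‖ ≤ ∑ i, |(y - x) i| * N (Pi.single i 1) := by
    intro y
    have h1 := h.add (y - x) x
    have h2 := h.add (x - y) y
    have h3 : N (x - y) = N (y - x) := by
      have := h.smul (-1) (y - x)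
      simpa using this
    rw [h3] at h2
    simp only [sub_add_cancel] at h1 h2
    have := h.le_sum (y - x)
    rw [Real.norm_eq_abs, abs_le]
    constructor <;> linarith
  rw [ContinuousAt, tendsto_iff_norm_sub_tendsto_zero]
  refine squeeze_zero (fun _ => norm_nonneg _) hb ?_
  have hc : Continuous (fun y : Fin d → ℝ => ∑ i, |(y - x) i| * N (Pi.single i 1)) := by
    fun_prop
  have := hc.tendsto x
  simpa using this

def ball (N : (Fin d → ℝ) → ℝ) : Set (Fin d → ℝ) := {x | N x < 1}

lemma isOpen_ball (h : NormLike N) : IsOpen (ball N) := isOpen_lt h.cont continuous_const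

lemma ball_bdd (h : NormLike N) : Bornology.IsBounded (ball N) := by
  rw [← Bornology.forall_isBounded_image_eval_iff]
  intro i
  refine (Metric.isBounded_Icc (-(N (Pi.single i 1))⁻¹) ((N (Pi.single i 1))⁻¹)).subset ?_
  rintro _ ⟨x, hx, rfl⟩
  have h1 := h.coord_le x i
  have h2 := h.single_pos i
  have h3 : N x < 1 := hx
  rw [Set.mem_Icc, ← abs_le, ← one_div, le_div_iff₀ h2]
  exact h1.trans h3.le

open MeasureTheory

lemma intg (h : NormLike N) (φ : (Fin d → ℝ) → ℝ) (hφ : Continuous φ) :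
    IntegrableOn φ (ball N) := by
  obtain ⟨r, hr⟩ := h.ball_bdd.subset_closedBall 0
  exact (hφ.continuousOn.integrableOn_compact (isCompact_closedBall _ _)).mono_set hr

lemma diag_pos (h : NormLike N) (i : Fin d) : 0 < ∫ x in ball N, x i * x i := by
  rw [setIntegral_pos_iff_support_of_nonneg_ae]
  · have ho : IsOpen ((Function.support fun x : Fin d → ℝ => x i * x i) ∩ ball N) := by
      refine IsOpen.inter ?_ h.isOpen_ball
      exact isOpen_ne_fun (by fun_prop) continuous_const
    refine ho.measure_pos _ ⟨Pi.single i (2 * N (Pi.single i 1))⁻¹, ?_, ?_⟩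
    · have := h.single_pos i
      simp [this.ne']
    · have := h.single_pos i
      change N _ < 1
      rw [h.single_eq, abs_of_pos (by positivity)]
      field_simp
      norm_num
  · filter_upwards with x
    exact mul_self_nonneg _
  · exact h.intg _ (by fun_prop)

lemma change {N' : (Fin d → ℝ) → ℝ} (h : NormLike N) (h' : NormLike N') (U : (Fin d → ℝ) →ₗ[ℝ] (Fin d → ℝ))
    (hU : LinearMap.det U ≠ 0) (hi : ∀ x, N' (U x) = N x) (φ : (Fin d → ℝ) → ℝ) :
    ∫ x in ball N, φ (U x) = |LinearMap.det U|⁻¹ * ∫ y in ball N', φ y := by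
  rw [← integral_indicator h'.isOpen_ball.measurableSet,
    ← integral_indicator h.isOpen_ball.measurableSet, ← aux_change U hU]
  congr 1
  ext x
  have hm : U x ∈ ball N' ↔ x ∈ ball N := by simp [ball, hi]
  by_cases hx : x ∈ ball N
  · rw [Set.indicator_of_mem hx, Set.indicator_of_mem (hm.2 hx)]
  · rw [Set.indicator_of_notMem hx, Set.indicator_of_notMem (fun h => hx (hm.1 h))]

lemma off_diag (h : NormLike N) (i j : Fin d) (hij : i ≠ j) : ∫ x in ball N, x i * x j = 0 := by
  classical
  let D : Matrix (Fin d) (Fin d) ℝ := Matrix.diagonal (fun m => if m = i then -1 else 1)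
  have hdet : LinearMap.det (Matrix.toLin' D) = -1 := by
    rw [LinearMap.det_toLin', Matrix.det_diagonal]
    simp
  have hD : ∀ x m, (Matrix.toLin' D) x m = (if m = i then -1 else 1) * x m := by
    intro x m
    simp [D, Matrix.mulVec_diagonal]
  have hi : ∀ x, N (Matrix.toLin' D x) = N x := by
    intro x
    apply le_antisymm <;> apply h.unc <;> intro m <;> rw [hD] <;> split_ifs <;> simp
  have := h.change h (Matrix.toLin' D) (by rw [hdet]; norm_num) hi (fun x => x i * x j)
  rw [hdet] at this
  simp only [hD, if_true, if_neg hij.symm] at this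
  simp only [neg_mul, one_mul, integral_neg, abs_neg, abs_one, inv_one] at this
  linarith

lemma pc (h : NormLike N) {p : ℝ} (hp : 2 < p) (hpc : ∀ (m : ℕ) (xs : Fin m → (Fin d → ℝ)),
      N (fun i => (∑ j, |xs j i| ^ p) ^ (1 / p)) ≤ (∑ j, N (xs j) ^ p) ^ (1 / p)) (v : Fin d → ℝ) :
    N v ^ p ≤ ∑ i, N (Pi.single i (v i)) ^ p := by
  have h0 := hpc d (fun j => Pi.single j (v j))
  have h1 : ∀ i, (∑ j, |(Pi.single j (v j) : Fin d → ℝ) i| ^ p) ^ (1 / p) = |v i| := by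
    intro i
    rw [Finset.sum_eq_single i]
    · rw [Pi.single_eq_same, one_div, Real.rpow_rpow_inv (abs_nonneg _) (by linarith)]
    · intro j _ hj
      rw [Pi.single_eq_of_ne hj.symm, abs_zero, Real.zero_rpow (by linarith)]
    · simp
  simp only [h1] at h0
  have h2 : N v ≤ N (fun i => |v i|) := h.unc _ _ (by simp)
  have h3 : 0 ≤ ∑ i, N (Pi.single i (v i)) ^ p :=
    Finset.sum_nonneg fun i _ => Real.rpow_nonneg (h.nonneg _) _
  calc N v ^ p ≤ ((∑ i, N (Pi.single i (v i)) ^ p) ^ (1 / p)) ^ p :=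
        Real.rpow_le_rpow (h.nonneg _) (h2.trans h0) (by linarith)
    _ = _ := by rw [one_div, Real.rpow_inv_rpow h3 (by linarith)]

end NormLike

lemma aux_orth {d : ℕ} (C : Matrix (Fin d) (Fin d) ℝ) (hC : C * C.transpose = 1) {p : ℝ} (hp : 2 < p)
    (α β : Fin d → ℝ) (hα : ∀ i, 0 < α i) (hβ : ∀ i, 0 < β i)
    (h1 : ∀ m, β m ≤ ∑ i, |C i m| ^ p * α i) (h2 : ∀ i, α i ≤ ∑ m, |C i m| ^ p * β m)
    (i k l : Fin d) (hk : C i k ≠ 0) (hl : C i l ≠ 0) : k = l := by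
  have hC' := mul_eq_one_comm.1 hC
  have row : ∀ i, ∑ m, C i m ^ 2 = 1 := by
    intro i
    have := congrFun (congrFun hC i) i
    simpa [Matrix.mul_apply, sq] using this
  have col : ∀ m, ∑ i, C i m ^ 2 = 1 := by
    intro m
    have := congrFun (congrFun hC' m) m
    simpa [Matrix.mul_apply, sq] using this
  have le1 : ∀ i m, |C i m| ≤ 1 := by
    intro i m
    rw [← sq_le_one_iff_abs_le_one, ← row i]
    exact Finset.single_le_sum (f := fun m => C i m ^ 2) (fun m _ => sq_nonneg _) (Finset.mem_univ m)
  have ple : ∀ i m, |C i m| ^ p ≤ C i m ^ 2 := by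
    intro i m
    rw [← sq_abs, ← Real.rpow_natCast]
    rcases (abs_nonneg (C i m)).eq_or_lt with h | h
    · rw [← h, Real.zero_rpow (by linarith)]; simp
    · exact Real.rpow_le_rpow_of_exponent_ge h (le1 i m) (by norm_num; linarith)
  have prow : ∀ i, ∑ m, |C i m| ^ p ≤ 1 := fun i => (row i) ▸ Finset.sum_le_sum fun m _ => ple i m
  have pcol : ∀ m, ∑ i, |C i m| ^ p ≤ 1 := fun m => (col m) ▸ Finset.sum_le_sum fun i _ => ple i m
  have s1 : ∑ m, β m ≤ ∑ i, (∑ m, |C i m| ^ p) * α i := by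
    simp only [Finset.sum_mul]
    rw [Finset.sum_comm]
    exact Finset.sum_le_sum fun m _ => h1 m
  have s2 : ∑ i, α i ≤ ∑ m, (∑ i, |C i m| ^ p) * β m := by
    simp only [Finset.sum_mul]
    rw [Finset.sum_comm]
    exact Finset.sum_le_sum fun m _ => h2 m
  have s3 : ∑ m, (∑ i, |C i m| ^ p) * β m ≤ ∑ m, β m :=
    Finset.sum_le_sum fun m _ => mul_le_of_le_one_left (hβ m).le (pcol m)
  have s4 : ∀ i ∈ Finset.univ, (∑ m, |C i m| ^ p) * α i ≤ α i :=
    fun i _ => mul_le_of_le_one_left (hα i).le (prow i)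
  have s5 := (Finset.sum_eq_sum_iff_of_le s4).1 (le_antisymm (Finset.sum_le_sum s4) (by linarith)) i
    (Finset.mem_univ i)
  have s6 : ∑ m, |C i m| ^ p = 1 := by
    have := (hα i).ne'
    field_simp at s5
    exact s5
  have s7 : ∀ m, |C i m| ^ p = C i m ^ 2 := fun m =>
    (Finset.sum_eq_sum_iff_of_le (fun m _ => ple i m)).1 (s6.trans (row i).symm) m (Finset.mem_univ m)
  have s8 : ∀ m, C i m ≠ 0 → C i m ^ 2 = 1 := by
    intro m hm
    by_contra hne
    have hlt : |C i m| < 1 := by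
      refine lt_of_le_of_ne (le1 i m) fun h => hne ?_
      rw [← sq_abs, h]; norm_num
    have := Real.rpow_lt_rpow_of_exponent_gt (abs_pos.2 hm) hlt hp
    rw [s7, Real.rpow_two, sq_abs] at this
    exact lt_irrefl _ this
  by_contra hkl
  have := Finset.add_le_sum (f := fun m => C i m ^ 2) (s := Finset.univ) (fun m _ => sq_nonneg _)
    (Finset.mem_univ k) (Finset.mem_univ l) hkl
  rw [row i, s8 k hk, s8 l hl] at this
  norm_num at this

open MeasureTheory NormLike in
lemma aux_main {d : ℕ} {NX NY : (Fin d → ℝ) → ℝ} (hX : NormLike NX) (hY : NormLike NY)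
    {p : ℝ} (hp : 2 < p)
    (hNX_pconv : ∀ (m : ℕ) (xs : Fin m → (Fin d → ℝ)),
      NX (fun i => (∑ j, |xs j i| ^ p) ^ (1 / p)) ≤
        (∑ j, NX (xs j) ^ p) ^ (1 / p))
    (hNY_pconv : ∀ (m : ℕ) (xs : Fin m → (Fin d → ℝ)),
      NY (fun i => (∑ j, |xs j i| ^ p) ^ (1 / p)) ≤
        (∑ j, NY (xs j) ^ p) ^ (1 / p))
    (U : (Fin d → ℝ) →ₗ[ℝ] (Fin d → ℝ))
    (hU_isom : ∀ x, NY (U x) = NX x) (w : Fin d → ℝ) (ν : Fin d) (hw : U w = Pi.single ν 1)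
    (k l : Fin d) (hk : w k ≠ 0) (hl : w l ≠ 0) : k = l := by
  have hinj : Function.Injective U := by
    rw [← LinearMap.ker_eq_bot, LinearMap.ker_eq_bot']
    intro x hx
    apply hX.ne
    rw [← hU_isom, hx, hY.zero]
  have hdet : LinearMap.det U ≠ 0 := by
    intro h0
    have := LinearMap.bot_lt_ker_of_det_eq_zero h0
    rw [LinearMap.ker_eq_bot.2 hinj] at this
    exact lt_irrefl _ this
  set A : Matrix (Fin d) (Fin d) ℝ := LinearMap.toMatrix' U with hA
  have hUA : ∀ x i, U x i = ∑ m, A i m * x m := by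
    intro x i
    rw [← LinearMap.toMatrix'_mulVec]; rfl
  let σ : Fin d → ℝ := fun m => |LinearMap.det U| * ∫ x in ball NX, x m * x m
  let τ : Fin d → ℝ := fun m => ∫ x in ball NY, x m * x m
  have hσ : ∀ m, 0 < σ m := fun m => mul_pos (abs_pos.2 hdet) (hX.diag_pos m)
  have hτ : ∀ m, 0 < τ m := fun m => hY.diag_pos m
  have hcov : ∀ i j, ∑ m, A i m * A j m * σ m = if i = j then τ i else 0 := by
    intro i j
    have h1 := hX.change hY U hdet hU_isom (fun y => y i * y j)
    have h2 : ∫ x in ball NX, U x i * U x j = ∑ m, A i m * A j m * ∫ x in ball NX, x m * x m := by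
      simp only [hUA, Finset.sum_mul_sum]
      rw [integral_finsetSum _ (fun m _ => hX.intg _ (by fun_prop))]
      refine Finset.sum_congr rfl fun m _ => ?_
      rw [integral_finsetSum _ (fun m _ => hX.intg _ (by fun_prop))]
      rw [Finset.sum_eq_single m]
      · rw [← integral_const_mul]
        congr 1; ext x; ring
      · intro n _ hn
        rw [← mul_zero (A i m * A j n), ← hX.off_diag m n hn.symm, ← integral_const_mul]
        congr 1; ext x; ring
      · simp
    have h3 : ∫ y in ball NY, y i * y j = if i = j then τ i else 0 := by
      split_ifs with h
      · subst h; rfl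
      · exact hY.off_diag i j h
    rw [h2, h3] at h1
    have h4 : (if i = j then τ i else 0) = |LinearMap.det U| * ∑ m, A i m * A j m * ∫ x in ball NX, x m * x m := by
      rw [h1, mul_inv_cancel_left₀ (abs_ne_zero.2 hdet)]
    rw [h4, Finset.mul_sum]
    refine Finset.sum_congr rfl fun m _ => ?_
    simp only [σ]; ring
  let a : Fin d → ℝ := fun i => √(τ i)
  let b : Fin d → ℝ := fun m => √(σ m)
  have ha : ∀ i, 0 < a i := fun i => Real.sqrt_pos.2 (hτ i)
  have hb : ∀ i, 0 < b i := fun i => Real.sqrt_pos.2 (hσ i)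
  have ha2 : ∀ i, a i * a i = τ i := fun i => Real.mul_self_sqrt (hτ i).le
  have hb2 : ∀ i, b i * b i = σ i := fun i => Real.mul_self_sqrt (hσ i).le
  let C : Matrix (Fin d) (Fin d) ℝ := fun i m => A i m * b m / a i
  have hC : C * C.transpose = 1 := by
    ext i j
    rw [Matrix.mul_apply, Matrix.one_apply]
    have : ∑ m, C i m * C.transpose m j = (∑ m, A i m * A j m * σ m) / (a i * a j) := by
      rw [Finset.sum_div]
      refine Finset.sum_congr rfl fun m _ => ?_
      rw [Matrix.transpose_apply]
      simp only [C, ← hb2]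
      have := (ha i).ne'
      have := (ha j).ne'
      field_simp
    rw [this, hcov]
    split_ifs with h
    · subst h
      rw [ha2, div_self (hτ i).ne']
    · simp
  have hC' := mul_eq_one_comm.1 hC
  have hUb : ∀ m, U (Pi.single m (b m)) = fun i => C i m * a i := by
    intro m
    ext i
    rw [hUA, Finset.sum_eq_single m]
    · simp only [C, Pi.single_eq_same]
      have := (ha i).ne'
      field_simp
    · intro n _ hn; simp [hn]
    · simp
  have hUa : ∀ i, U (fun m => C i m * b m) = Pi.single i (a i) := by
    intro i
    ext j
    rw [hUA]
    have h1 : ∑ m, A j m * (C i m * b m) = a j * (C * C.transpose) j i := by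
      rw [Matrix.mul_apply, Finset.mul_sum]
      refine Finset.sum_congr rfl fun m _ => ?_
      rw [Matrix.transpose_apply]
      simp only [C]
      have := (ha i).ne'
      have := (ha j).ne'
      field_simp
    rw [h1, hC, Matrix.one_apply, Pi.single_apply]
    split_ifs with h
    · subst h; simp
    · simp
  have hmul : ∀ {N : (Fin d → ℝ) → ℝ} (_ : NormLike N) (i : Fin d) (c e : ℝ),
      N (Pi.single i (c * e)) ^ p = |c| ^ p * N (Pi.single i e) ^ p := by
    intro N hN i c e
    rw [← Real.mul_rpow (abs_nonneg _) (hN.nonneg _), ← hN.smul, ← Pi.single_smul]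
    simp
  have hwC : ∀ m, w m = C ν m * b m / a ν := by
    have : w = (a ν)⁻¹ • (fun m => C ν m * b m) := by
      apply hinj
      rw [map_smul, hUa, hw, ← Pi.single_smul, smul_eq_mul, inv_mul_cancel₀ (ha ν).ne']
    intro m
    rw [this]
    simp [div_eq_inv_mul]
  refine aux_orth C hC hp (fun i => NY (Pi.single i (a i)) ^ p) (fun i => NX (Pi.single i (b i)) ^ p)
    (fun i => Real.rpow_pos_of_pos (hY.pos (by simpa using (ha i).ne')) _)
    (fun i => Real.rpow_pos_of_pos (hX.pos (by simpa using (hb i).ne')) _) ?_ ?_ ν k l ?_ ?_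
  · intro m
    have := hY.pc hp hNY_pconv (fun i => C i m * a i)
    rw [← hUb, hU_isom] at this
    simpa only [hmul hY] using this
  · intro i
    have := hX.pc hp hNX_pconv (fun m => C i m * b m)
    rw [← hU_isom, hUa] at this
    simpa only [hmul hX] using this
  · intro h; apply hk; rw [hwC, h]; simp
  · intro h; apply hl; rw [hwC, h]; simp


theorem stmt15 (d : ℕ) (hd : 3 ≤ d)
    (NX NY : (Fin d → ℝ) → ℝ)
    (hNX_add : ∀ x y, NX (x + y) ≤ NX x + NX y)
    (hNX_smul : ∀ (c : ℝ) (x), NX (c • x) = |c| * NX x)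
    (hNX_def : ∀ x, NX x = 0 → x = 0)
    (hNY_add : ∀ x y, NY (x + y) ≤ NY x + NY y)
    (hNY_smul : ∀ (c : ℝ) (x), NY (c • x) = |c| * NY x)
    (hNY_def : ∀ x, NY x = 0 → x = 0)
    (hNX_uncond : ∀ x y : Fin d → ℝ, (∀ i, |x i| ≤ |y i|) → NX x ≤ NX y)
    (hNY_uncond : ∀ x y : Fin d → ℝ, (∀ i, |x i| ≤ |y i|) → NY x ≤ NY y)
    (hNX_strict : ∀ x y : Fin d → ℝ, (∀ i, |x i| ≤ |y i|) →
      (∃ i, |x i| < |y i|) → NX x < NX y)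
    (hNY_strict : ∀ x y : Fin d → ℝ, (∀ i, |x i| ≤ |y i|) →
      (∃ i, |x i| < |y i|) → NY x < NY y)
    (p : ℝ) (hp : 2 < p)
    (hNX_pconv : ∀ (m : ℕ) (xs : Fin m → (Fin d → ℝ)),
      NX (fun i => (∑ j, |xs j i| ^ p) ^ (1 / p)) ≤
        (∑ j, NX (xs j) ^ p) ^ (1 / p))
    (hNY_pconv : ∀ (m : ℕ) (xs : Fin m → (Fin d → ℝ)),
      NY (fun i => (∑ j, |xs j i| ^ p) ^ (1 / p)) ≤
        (∑ j, NY (xs j) ^ p) ^ (1 / p))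
    (U : (Fin d → ℝ) →ₗ[ℝ] (Fin d → ℝ))
    (hU_surj : Function.Surjective U)
    (hU_isom : ∀ x, NY (U x) = NX x)
    (g : Fin d → ((Fin d → ℝ) →ₗ[ℝ] ℝ))
    (hg_ne : ∀ m, g m ≠ 0)
    (hg_ker : ∀ m, Submodule.map U (LinearMap.ker (LinearMap.proj m :
      (Fin d → ℝ) →ₗ[ℝ] ℝ)) = LinearMap.ker (g m)) :
    ∀ k l t : Fin d, l ≠ k → t ≠ k →
      ({ν : Fin d | g l ((Pi.single ν 1 : Fin d → ℝ)) ≠ 0} ∩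
        {ν : Fin d | g k ((Pi.single ν 1 : Fin d → ℝ)) ≠ 0}).Nonempty →
      ({ν : Fin d | g t ((Pi.single ν 1 : Fin d → ℝ)) ≠ 0} ∩
        {ν : Fin d | g k ((Pi.single ν 1 : Fin d → ℝ)) ≠ 0}).Nonempty →
      l = t := by
  intro k l t hlk htk h1 _
  exfalso
  obtain ⟨ν, hν1, hν2⟩ := h1
  obtain ⟨w, hw⟩ := hU_surj (Pi.single ν 1)
  have key : ∀ m, g m (Pi.single ν 1) ≠ 0 → w m ≠ 0 := by
    intro m hm h0
    apply hm
    have : U w ∈ LinearMap.ker (g m) := by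
      rw [← hg_ker]
      exact Submodule.mem_map_of_mem (by simpa using h0)
    rwa [hw] at this
  exact hlk (aux_main ⟨hNX_add, hNX_smul, hNX_def, hNX_uncond⟩ ⟨hNY_add, hNY_smul, hNY_def, hNY_uncond⟩
    hp hNX_pconv hNY_pconv U hU_isom w ν hw l k (key l hν1) (key k hν2))
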